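/- arXiv:2511.18540 — 2 statements merged into one kernel-verified Lean document; each statement's English description precedes it below -/
import Mathlib

section
/- Let L = E[C_1, …, C_n] be a congruence normal lattice, obtained from the one-element lattice by successively doubling the nonempty convex subsets C_1, …, C_n. Then L is left modular if and only if for every i ∈ {1, …, n}, the heart H(C_i) contains an element that lies on some maximal chain of E[C_1, …, C_{i−1}] consisting of left modular elements. -/
universe u

/-- An element `a` of a lattice is left modular if for all `b < c`,
`(b ⊔ a) ⊓ c = b ⊔ (a ⊓ c)`. -/
def LeftModular {α : Type u} [Lattice α] (a : α) : Prop :=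
  ∀ b c : α, b < c → (b ⊔ a) ⊓ c = b ⊔ (a ⊓ c)

/-- A lattice is left modular if it has a maximal chain all of whose elements
are left modular. -/
def IsLeftModularLattice (β : Type u) [Lattice β] : Prop :=
  ∃ s : Set β, IsMaxChain (· ≤ ·) s ∧ ∀ a ∈ s, LeftModular a

/-- The order ideal `I_L(C)` generated by a subset `C`. -/
def lowerIdeal {α : Type u} [Preorder α] (C : Set α) : Set α :=
  {y : α | ∃ x ∈ C, y ≤ x}

/-- The underlying subset of `L × {0,1}` of Day's doubling `L[C]`:
`(I_L(C) × {0}) ∪ (((L \ I_L(C)) ∪ C) × {1})`. -/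
def doublingSet {α : Type u} [Preorder α] (C : Set α) : Set (α × Bool) :=
  {p : α × Bool | (p.2 = false ∧ p.1 ∈ lowerIdeal C) ∨
    (p.2 = true ∧ (p.1 ∉ lowerIdeal C ∨ p.1 ∈ C))}

/-- Day's doubling `L[C]`, as a subposet of the product `L × {0,1}` where `0 < 1`. -/
abbrev Doubling {α : Type u} [Preorder α] (C : Set α) : Type u :=
  {p : α × Bool // p ∈ doublingSet C}

/-- The heart `H(C)` of a subset `C` of a lattice: the set of elements of `C` that are
below every maximal element of `C` and above every minimal element of `C`. -/
def heart {α : Type u} [Lattice α] (C : Set α) : Set α :=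
  {a : α | a ∈ C ∧ (∀ M : α, Maximal (· ∈ C) M → a ≤ M) ∧
    (∀ m : α, Minimal (· ∈ C) m → m ≤ a)}

section Doubling

variable {α β : Type u} [Lattice α] [Lattice β] {C : Set α}

theorem LeftModular.eq_of_le {a b c : α} (h : LeftModular a) (hbc : b ≤ c) :
    (b ⊔ a) ⊓ c = b ⊔ (a ⊓ c) := by
  rcases hbc.eq_or_lt with rfl | hlt
  · rw [inf_eq_right.2 le_sup_left, sup_eq_left.2 inf_le_right]
  · exact h b c hlt

theorem mem_of_isMaxChain {s : Set α} (hs : IsMaxChain (· ≤ ·) s) {x : α}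
    (hx : ∀ y ∈ s, x ≤ y ∨ y ≤ x) : x ∈ s := by
  have h := hs.2 (hs.1.insert (a := x) fun y hy _ => hx y hy) (Set.subset_insert x s)
  rw [h]
  exact Set.mem_insert x s

theorem isMaxChain_of_mem {s : Set α} (hs : IsChain (· ≤ ·) s)
    (h : ∀ x, (∀ y ∈ s, x ≤ y ∨ y ≤ x) → x ∈ s) : IsMaxChain (· ≤ ·) s :=
  ⟨hs, fun _ ht hst => hst.antisymm fun x hx => h x fun _ hy => ht.total hx (hst hy)⟩

/-- The elements of `α` with a copy in the upper level of the doubling of `C`. -/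
def upperPart (C : Set α) : Set α := {x | x ∉ lowerIdeal C ∨ x ∈ C}

theorem mem_lowerIdeal_of_mem {x : α} (hx : x ∈ C) : x ∈ lowerIdeal C := ⟨x, hx, le_rfl⟩

theorem mem_lowerIdeal_of_le {x y : α} (hy : y ∈ lowerIdeal C) (hxy : x ≤ y) :
    x ∈ lowerIdeal C := by
  obtain ⟨c, hc, hyc⟩ := hy
  exact ⟨c, hc, hxy.trans hyc⟩

theorem mem_of_mem_lowerIdeal (hC : C.OrdConnected) {x y : α} (hx : x ∈ C) (hxy : x ≤ y)
    (hy : y ∈ lowerIdeal C) : y ∈ C := by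
  obtain ⟨c, hc, hyc⟩ := hy
  exact hC.out hx hc ⟨hxy, hyc⟩

theorem mem_upperPart_of_mem {x : α} (hx : x ∈ C) : x ∈ upperPart C := Or.inr hx

theorem mem_upperPart_of_notMem {x : α} (hx : x ∉ lowerIdeal C) : x ∈ upperPart C := Or.inl hx

theorem mem_of_mem_upperPart {x : α} (hx : x ∈ upperPart C) (hI : x ∈ lowerIdeal C) : x ∈ C :=
  hx.resolve_left fun h => h hI

theorem mem_upperPart_of_le (hC : C.OrdConnected) {x y : α} (hx : x ∈ upperPart C)
    (hxy : x ≤ y) : y ∈ upperPart C := by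
  by_cases hy : y ∈ lowerIdeal C
  · exact Or.inr (mem_of_mem_lowerIdeal hC
      (mem_of_mem_upperPart hx (mem_lowerIdeal_of_le hy hxy)) hxy hy)
  · exact Or.inl hy

namespace Doubling

/-- The projection of a lattice isomorphic to the doubling of `C` onto the original lattice. -/
def proj (e : β ≃o Doubling C) (b : β) : α := (e b).1.1

/-- The level (upper or lower) of an element of a lattice isomorphic to the doubling of `C`. -/
def level (e : β ≃o Doubling C) (b : β) : Bool := (e b).1.2

/-- The lower copy of an element of the ideal generated by `C`. -/
def lower (e : β ≃o Doubling C) (x : α) (hx : x ∈ lowerIdeal C) : β :=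
  e.symm ⟨(x, false), Or.inl ⟨rfl, hx⟩⟩

/-- The upper copy of an element. -/
def upper (e : β ≃o Doubling C) (x : α) (hx : x ∈ upperPart C) : β :=
  e.symm ⟨(x, true), Or.inr ⟨rfl, hx⟩⟩

variable (e : β ≃o Doubling C)

@[simp] theorem proj_lower {x : α} (hx) : proj e (lower e x hx) = x := by simp [proj, lower]

@[simp] theorem proj_upper {x : α} (hx) : proj e (upper e x hx) = x := by simp [proj, upper]

@[simp] theorem level_lower {x : α} (hx) : level e (lower e x hx) = false := by
  simp [level, lower]

@[simp] theorem level_upper {x : α} (hx) : level e (upper e x hx) = true := by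
  simp [level, upper]

theorem le_iff {a b : β} :
    a ≤ b ↔ proj e a ≤ proj e b ∧ (level e a = true → level e b = true) := by
  rw [← e.le_iff_le, ← Subtype.coe_le_coe, Prod.le_def]
  exact Iff.rfl

theorem proj_mono {a b : β} (h : a ≤ b) : proj e a ≤ proj e b := ((le_iff e).1 h).1

theorem level_mono {a b : β} (h : a ≤ b) (ha : level e a = true) : level e b = true :=
  ((le_iff e).1 h).2 ha

theorem eq_of_proj_of_level {a b : β} (hp : proj e a = proj e b)
    (hl : level e a = true ↔ level e b = true) : a = b :=
  le_antisymm ((le_iff e).2 ⟨hp.le, hl.1⟩) ((le_iff e).2 ⟨hp.ge, hl.2⟩)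

theorem proj_mem_lowerIdeal {a : β} (h : ¬ level e a = true) : proj e a ∈ lowerIdeal C :=
  (e a).2.elim (fun h' => h'.2) fun h' => absurd h'.1 h

theorem proj_mem_upperPart {a : β} (h : level e a = true) : proj e a ∈ upperPart C :=
  (e a).2.elim (fun h' => absurd (h.symm.trans h'.1) (by simp)) fun h' => h'.2

theorem proj_sup (hC : C.OrdConnected) (a b : β) :
    proj e (a ⊔ b) = proj e a ⊔ proj e b := by
  refine le_antisymm ?_ (sup_le (proj_mono e le_sup_left) (proj_mono e le_sup_right))
  by_cases h : proj e a ⊔ proj e b ∈ upperPart C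
  · have : a ⊔ b ≤ upper e _ h := sup_le ((le_iff e).2 (by simp)) ((le_iff e).2 (by simp))
    simpa using proj_mono e this
  · have hI : proj e a ⊔ proj e b ∈ lowerIdeal C := by
      by_contra hI
      exact h (Or.inl hI)
    have ha : ¬ level e a = true := fun ha =>
      h (mem_upperPart_of_le hC (proj_mem_upperPart e ha) le_sup_left)
    have hb : ¬ level e b = true := fun hb =>
      h (mem_upperPart_of_le hC (proj_mem_upperPart e hb) le_sup_right)
    have : a ⊔ b ≤ lower e _ hI :=
      sup_le ((le_iff e).2 (by simp [ha])) ((le_iff e).2 (by simp [hb]))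
    simpa using proj_mono e this

theorem proj_inf (a b : β) : proj e (a ⊓ b) = proj e a ⊓ proj e b := by
  refine le_antisymm (le_inf (proj_mono e inf_le_left) (proj_mono e inf_le_right)) ?_
  by_cases h : proj e a ⊓ proj e b ∈ lowerIdeal C
  · have : lower e _ h ≤ a ⊓ b := le_inf ((le_iff e).2 (by simp)) ((le_iff e).2 (by simp))
    simpa using proj_mono e this
  · have ha : level e a = true := by
      by_contra ha
      exact h (mem_lowerIdeal_of_le (proj_mem_lowerIdeal e ha) inf_le_left)
    have hb : level e b = true := by
      by_contra hb
      exact h (mem_lowerIdeal_of_le (proj_mem_lowerIdeal e hb) inf_le_right)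
    have : upper e _ (mem_upperPart_of_notMem h) ≤ a ⊓ b :=
      le_inf ((le_iff e).2 (by simp [ha])) ((le_iff e).2 (by simp [hb]))
    simpa using proj_mono e this

theorem level_sup (hC : C.OrdConnected) (a b : β) :
    level e (a ⊔ b) = true ↔
      level e a = true ∨ level e b = true ∨ proj e a ⊔ proj e b ∉ lowerIdeal C := by
  constructor
  · intro h
    by_contra! hn
    obtain ⟨ha, hb, hI⟩ := hn
    have : a ⊔ b ≤ lower e _ hI :=
      sup_le ((le_iff e).2 (by simp [ha])) ((le_iff e).2 (by simp [hb]))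
    simpa using level_mono e this h
  · rintro (h | h | h)
    · exact level_mono e le_sup_left h
    · exact level_mono e le_sup_right h
    · by_contra hl
      exact h (proj_sup e hC a b ▸ proj_mem_lowerIdeal e hl)

theorem level_inf (a b : β) :
    level e (a ⊓ b) = true ↔
      level e a = true ∧ level e b = true ∧ proj e a ⊓ proj e b ∈ upperPart C := by
  constructor
  · intro h
    exact ⟨level_mono e inf_le_left h, level_mono e inf_le_right h,
      proj_inf e a b ▸ proj_mem_upperPart e h⟩
  · rintro ⟨ha, hb, hU⟩
    have : upper e _ hU ≤ a ⊓ b :=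
      le_inf ((le_iff e).2 (by simp [ha])) ((le_iff e).2 (by simp [hb]))
    exact level_mono e this (by simp)

theorem exists_proj_eq (x : α) : ∃ b, proj e b = x := by
  by_cases h : x ∈ lowerIdeal C
  · exact ⟨lower e x h, by simp⟩
  · exact ⟨upper e x (mem_upperPart_of_notMem h), by simp⟩

theorem leftModular_proj (hC : C.OrdConnected) {a : β} (ha : LeftModular a) :
    LeftModular (proj e a) := by
  intro x y hxy
  obtain ⟨b, rfl⟩ := exists_proj_eq e x
  obtain ⟨c, rfl⟩ := exists_proj_eq e y
  have hc : proj e (b ⊔ c) = proj e c := by rw [proj_sup e hC, sup_eq_right.2 hxy.le]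
  have h := congrArg (proj e) (ha.eq_of_le (le_sup_left : b ≤ b ⊔ c))
  rwa [proj_inf, proj_sup e hC b a, proj_sup e hC b (a ⊓ _), proj_inf, hc] at h

/-- The join of `C` with a left modular element of lower level stays in the ideal of `C`. -/
theorem sup_mem_lowerIdeal (hC : C.OrdConnected) {a : β} (ha : LeftModular a)
    (hl : ¬ level e a = true) {c : α} (hc : c ∈ C) : c ⊔ proj e a ∈ lowerIdeal C := by
  have hI := mem_lowerIdeal_of_mem hc
  have hU : c ∈ upperPart C := Or.inr hc
  have h := congrArg (fun z => level e z = true)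
    (ha.eq_of_le (b := lower e c hI) (c := upper e c hU) ((le_iff e).2 (by simp)))
  simp only [level_inf, level_sup e hC, proj_sup e hC, proj_inf, proj_lower, proj_upper,
    level_lower, level_upper, hl] at h
  rw [sup_eq_left.2 (inf_le_right : proj e a ⊓ c ≤ c),
    inf_eq_right.2 (le_sup_left : c ≤ c ⊔ proj e a)] at h
  simpa [hI, hU] using h

/-- The meet of `C` with a left modular element of upper level stays in `C`. -/
theorem inf_mem (hC : C.OrdConnected) {a : β} (ha : LeftModular a)
    (hl : level e a = true) {c : α} (hc : c ∈ C) : proj e a ⊓ c ∈ C := by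
  have hI := mem_lowerIdeal_of_mem hc
  have hU : c ∈ upperPart C := Or.inr hc
  have h := congrArg (fun z => level e z = true)
    (ha.eq_of_le (b := lower e c hI) (c := upper e c hU) ((le_iff e).2 (by simp)))
  simp only [level_inf, level_sup e hC, proj_sup e hC, proj_inf, proj_lower, proj_upper,
    level_lower, level_upper, hl] at h
  rw [sup_eq_left.2 (inf_le_right : proj e a ⊓ c ≤ c),
    inf_eq_right.2 (le_sup_left : c ≤ c ⊔ proj e a)] at h
  exact mem_of_mem_upperPart (by simpa [hI, hU] using h) (mem_lowerIdeal_of_le hI inf_le_right)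

/-- A maximal chain of left modular elements of the doubling of `C` contains both copies of
some element of `C`. -/
theorem exists_mem_isMaxChain [Finite β] (hne : C.Nonempty) (hC : C.OrdConnected) {s : Set β}
    (hs : IsMaxChain (· ≤ ·) s) (hlm : ∀ a ∈ s, LeftModular a) :
    ∃ p ∈ s, ∃ q ∈ s, ¬ level e p = true ∧ level e q = true ∧ proj e p = proj e q ∧
      proj e p ∈ C := by
  obtain ⟨c₀, hc₀⟩ := hne
  have hbot : ∃ z ∈ s, ¬ level e z = true := by
    have : Nonempty β := ⟨lower e c₀ (mem_lowerIdeal_of_mem hc₀)⟩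
    obtain ⟨m, hm⟩ := Finite.exists_ge (id : β → β)
    refine ⟨m, mem_of_isMaxChain hs fun y _ => Or.inl (hm y), fun h => ?_⟩
    simpa using level_mono e (hm (lower e c₀ (mem_lowerIdeal_of_mem hc₀))) h
  have htop : ∃ z ∈ s, level e z = true := by
    have : Nonempty β := ⟨lower e c₀ (mem_lowerIdeal_of_mem hc₀)⟩
    obtain ⟨m, hm⟩ := Finite.exists_le (id : β → β)
    exact ⟨m, mem_of_isMaxChain hs fun y _ => Or.inr (hm y),
      level_mono e (hm (upper e c₀ (mem_upperPart_of_mem hc₀))) (by simp)⟩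
  obtain ⟨p, ⟨hps, hpl⟩, hp⟩ :=
    (Set.toFinite {z | z ∈ s ∧ ¬ level e z = true}).exists_maximal hbot
  obtain ⟨q, ⟨hqs, hql⟩, hq⟩ :=
    (Set.toFinite {z | z ∈ s ∧ level e z = true}).exists_minimal htop
  have hp' : ∀ z ∈ s, ¬ level e z = true → z ≤ p := fun z hz hl =>
    (hs.1.total hz hps).elim id fun h => hp ⟨hz, hl⟩ h
  have hq' : ∀ z ∈ s, level e z = true → q ≤ z := fun z hz hl =>
    (hs.1.total hqs hz).elim id fun h => hq ⟨hz, hl⟩ h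
  have hpq : p ≤ q := (hs.1.total hps hqs).resolve_right fun h => hpl (level_mono e h hql)
  have hmem : ∀ z, p ≤ z → z ≤ q → z ∈ s := fun z hpz hzq =>
    mem_of_isMaxChain hs fun y hy => by
      by_cases hl : level e y = true
      · exact Or.inl (hzq.trans (hq' y hy hl))
      · exact Or.inr ((hp' y hy hl).trans hpz)
  have hpC : proj e p ∈ C := by
    obtain ⟨c, hc, hpc⟩ := proj_mem_lowerIdeal e hpl
    have hqc := inf_mem e hC (hlm q hqs) hql hc
    have hz := hmem (lower e _ (mem_lowerIdeal_of_mem hqc))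
      ((le_iff e).2 (by simp [hpl, hpc, proj_mono e hpq])) ((le_iff e).2 (by simp))
    exact hC.out hqc hc ⟨by simpa using proj_mono e (hp' _ hz (by simp)), hpc⟩
  have hz := hmem (upper e _ (mem_upperPart_of_mem hpC)) ((le_iff e).2 (by simp))
    ((le_iff e).2 (by simp [hql, proj_mono e hpq]))
  exact ⟨p, hps, q, hqs, hpl, hql, (proj_mono e hpq).antisymm
    (by simpa using proj_mono e (hq' _ hz (by simp))), hpC⟩

theorem exists_heart_of_isLeftModularLattice [Finite β] (e : β ≃o Doubling C)
    (hne : C.Nonempty) (hC : C.OrdConnected) (h : IsLeftModularLattice β) :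
    ∃ a ∈ heart C, ∃ s : Set α, IsMaxChain (· ≤ ·) s ∧ a ∈ s ∧ ∀ b ∈ s, LeftModular b := by
  obtain ⟨s, hs, hlm⟩ := h
  obtain ⟨p, hps, q, hqs, hpl, hql, hpq, hpC⟩ := exists_mem_isMaxChain e hne hC hs hlm
  refine ⟨proj e p, ⟨hpC, fun M hM => ?_, fun m hm => ?_⟩, proj e '' s, ?_, ⟨p, hps, rfl⟩, ?_⟩
  · exact le_sup_right.trans (hM.2 (mem_of_mem_lowerIdeal hC hM.1 le_sup_left
      (sup_mem_lowerIdeal e hC (hlm p hps) hpl hM.1)) le_sup_left)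
  · rw [hpq]
    exact (hm.2 (inf_mem e hC (hlm q hqs) hql hm.1) inf_le_right).trans inf_le_left
  · have hchain : IsChain (· ≤ ·) (proj e '' s) := by
      rintro _ ⟨y, hy, rfl⟩ _ ⟨z, hz, rfl⟩ -
      exact (hs.1.total hy hz).imp (proj_mono e) (proj_mono e)
    refine isMaxChain_of_mem hchain fun x hx => ?_
    rcases hx _ ⟨p, hps, rfl⟩ with hxp | hpx
    · have hI := mem_lowerIdeal_of_le (mem_lowerIdeal_of_mem hpC) hxp
      refine ⟨lower e x hI, mem_of_isMaxChain hs fun y hy => ?_, by simp⟩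
      by_cases hyl : level e y = true
      · have hqy : proj e p ≤ proj e y := by
          rcases hs.1.total hps hy with h | h
          · exact proj_mono e h
          · exact absurd (level_mono e h hyl) hpl
        exact Or.inl ((le_iff e).2 (by simp [hxp.trans hqy]))
      · simpa [le_iff e, hyl] using hx _ ⟨y, hy, rfl⟩
    · have hU := mem_upperPart_of_le hC (Or.inr hpC) hpx
      refine ⟨upper e x hU, mem_of_isMaxChain hs fun y hy => ?_, by simp⟩
      by_cases hyl : level e y = true
      · simpa [le_iff e, hyl] using hx _ ⟨y, hy, rfl⟩
      · have hyq : proj e y ≤ proj e p := by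
          rw [hpq]
          rcases hs.1.total hqs hy with h | h
          · exact absurd (level_mono e h hql) hyl
          · exact proj_mono e h
        exact Or.inr ((le_iff e).2 (by simp [hyq.trans hpx]))
  · rintro _ ⟨b, hb, rfl⟩
    exact leftModular_proj e hC (hlm b hb)

/-- A left modular element lifts to left modular elements of lower level below the heart
and of upper level above it. -/
theorem leftModular_of_proj [Finite α] (hC : C.OrdConnected) {a : α} (ha : a ∈ heart C)
    {z : β} (hz : LeftModular (proj e z)) (hlow : ¬ level e z = true → proj e z ≤ a)
    (hup : level e z = true → a ≤ proj e z) : LeftModular z := by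
  intro b c hbc
  have hproj : proj e ((b ⊔ z) ⊓ c) = proj e (b ⊔ z ⊓ c) := by
    simp only [proj_inf, proj_sup e hC]
    exact hz.eq_of_le (proj_mono e hbc.le)
  have hle : b ⊔ z ⊓ c ≤ (b ⊔ z) ⊓ c :=
    sup_le (le_inf le_sup_left hbc.le) (inf_le_inf_right c le_sup_right)
  refine eq_of_proj_of_level e hproj ⟨fun h => ?_, level_mono e hle⟩
  by_contra hr
  have hb : ¬ level e b = true := fun hb => hr (level_mono e le_sup_left hb)
  have hzc : ¬ level e (z ⊓ c) = true := fun hzc => hr (level_mono e le_sup_right hzc)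
  have hbz := level_mono e inf_le_left h
  have hc := level_mono e inf_le_right h
  by_cases hzl : level e z = true
  · have hpC : proj e ((b ⊔ z) ⊓ c) ∈ C := mem_of_mem_upperPart (proj_mem_upperPart e h)
      (hproj ▸ proj_mem_lowerIdeal e hr)
    obtain ⟨m, hmp, hm⟩ := (Set.toFinite C).exists_le_minimal hpC
    refine hzc ((level_inf e z c).2 ⟨hzl, hc, mem_upperPart_of_le hC (Or.inr hm.1) ?_⟩)
    exact le_inf ((ha.2.2 m hm).trans (hup hzl)) (hmp.trans (proj_mono e inf_le_right))
  · obtain ⟨d, hd, hbd⟩ := proj_mem_lowerIdeal e hb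
    obtain ⟨M, hdM, hM⟩ := (Set.toFinite C).exists_le_maximal hd
    rw [level_sup e hC] at hbz
    exact (hbz.resolve_left hb).resolve_left hzl
      ⟨M, hM.1, sup_le (hbd.trans hdM) ((hlow hzl).trans (ha.2.1 M hM))⟩

theorem isLeftModularLattice_of_exists_heart [Finite α] (e : β ≃o Doubling C)
    (hC : C.OrdConnected)
    (h : ∃ a ∈ heart C, ∃ s : Set α, IsMaxChain (· ≤ ·) s ∧ a ∈ s ∧ ∀ b ∈ s, LeftModular b) :
    IsLeftModularLattice β := by
  obtain ⟨a, ha, s, hs, has, hlm⟩ := h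
  have haI := mem_lowerIdeal_of_mem ha.1
  have haU : a ∈ upperPart C := Or.inr ha.1
  refine ⟨{z | proj e z ∈ s ∧ (¬ level e z = true → proj e z ≤ a) ∧
    (level e z = true → a ≤ proj e z)}, isMaxChain_of_mem ?_ fun z hz => ?_, ?_⟩
  · rintro x ⟨hxs, hxl, hxu⟩ y ⟨hys, hyl, hyu⟩ -
    have hxy := hs.1.total hxs hys
    by_cases hx : level e x = true <;> by_cases hy : level e y = true
    · simpa [le_iff e, hx, hy] using hxy
    · exact Or.inr ((le_iff e).2 ⟨(hyl hy).trans (hxu hx), fun _ => hx⟩)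
    · exact Or.inl ((le_iff e).2 ⟨(hxl hx).trans (hyu hy), fun _ => hy⟩)
    · simpa [le_iff e, hx, hy] using hxy
  · have hzl := hz (upper e a haU) (by simp [has])
    have hzu := hz (lower e a haI) (by simp [has])
    have hlow : ¬ level e z = true → proj e z ≤ a := fun hl => by
      simpa [le_iff e, hl] using hzl
    have hup : level e z = true → a ≤ proj e z := fun hl => by
      simpa [le_iff e, hl] using hzu
    refine ⟨mem_of_isMaxChain hs fun x hx => ?_, hlow, hup⟩
    rcases hs.1.total hx has with hxa | hax
    · have := hz (lower e x (mem_lowerIdeal_of_le haI hxa)) (by simp [hx, hxa])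
      exact this.imp (fun h => by simpa using proj_mono e h) fun h => by
        simpa using proj_mono e h
    · have := hz (upper e x (mem_upperPart_of_le hC haU hax)) (by simp [hx, hax])
      exact this.imp (fun h => by simpa using proj_mono e h) fun h => by
        simpa using proj_mono e h
  · rintro z ⟨hzs, hlow, hup⟩
    exact leftModular_of_proj e hC ha (hlm _ hzs) hlow hup

end Doubling

end Doubling

theorem isLeftModularLattice_of_subsingleton (α : Type u) [Lattice α] [Subsingleton α]
    [Nonempty α] : IsLeftModularLattice α :=
  ⟨Set.univ, isMaxChain_of_mem (fun x _ y _ h => absurd (Subsingleton.elim x y) h)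
    fun x _ => Set.mem_univ x, fun _ _ _ _ _ => Subsingleton.elim _ _⟩

/-- A congruence normal lattice `L = E[C_1, …, C_n]`, obtained from the one-element
lattice `K 0` by successively doubling nonempty convex subsets `C i` (so that
`K (i+1) ≅ (K i)[C i]` and `L = K n`), is left modular if and only if for every `i`
the heart `H(C i)` contains an element lying on some maximal chain of `K i`
consisting of left modular elements. -/
theorem congruenceNormal_leftModular_iff (n : ℕ) (K : Fin (n + 1) → Type u)
    [instK : ∀ i, Lattice (K i)] [instF : ∀ i, Fintype (K i)]
    (hone : Subsingleton (K 0)) (hone' : Nonempty (K 0))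
    (C : (i : Fin n) → Set (K i.castSucc))
    (hne : ∀ i, (C i).Nonempty) (hconv : ∀ i, (C i).OrdConnected)
    (e : (i : Fin n) → (K i.succ ≃o Doubling (C i))) :
    IsLeftModularLattice (K (Fin.last n)) ↔
      ∀ i : Fin n, ∃ a ∈ heart (C i), ∃ s : Set (K i.castSucc),
        IsMaxChain (· ≤ ·) s ∧ a ∈ s ∧ ∀ b ∈ s, LeftModular b := by
  constructor
  · intro h
    have hlm : ∀ i, IsLeftModularLattice (K i) := fun i => by
      induction i using Fin.reverseInduction with
      | last => exact h
      | cast i ih =>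
        obtain ⟨_, _, s, hs, _, hlm⟩ :=
          Doubling.exists_heart_of_isLeftModularLattice (e i) (hne i) (hconv i) ih
        exact ⟨s, hs, hlm⟩
    exact fun i =>
      Doubling.exists_heart_of_isLeftModularLattice (e i) (hne i) (hconv i) (hlm i.succ)
  · intro h
    cases n with
    | zero => exact isLeftModularLattice_of_subsingleton (K 0)
    | succ n =>
      exact Doubling.isLeftModularLattice_of_exists_heart (e (Fin.last n)) (hconv _) (h _)
end

section
/- Let L = E[C_1, …, C_n] be a congruence normal lattice, obtained from the one-element lattice by successively doubling the nonempty convex subsets C_1, …, C_n. Then L is extremal if and only if for every i ∈ {1, …, n}, the subset C_i is an interval of E[C_1, …, C_{i−1}] and C_i intersects the spine of E[C_1, …, C_{i−1}]. -/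
universe u

/-- A join-irreducible element of a finite lattice: an element covering exactly one element. -/
def IsJoinIrred {α : Type u} [Lattice α] (j : α) : Prop := ∃! b : α, b ⋖ j

/-- A meet-irreducible element of a finite lattice: an element covered by exactly one element. -/
def IsMeetIrred {α : Type u} [Lattice α] (m : α) : Prop := ∃! b : α, m ⋖ b

/-- The length of a finite poset: the maximum `n` such that there is a chain
`x_0 < x_1 < ⋯ < x_n`. -/
noncomputable def latLen (β : Type u) [Preorder β] : ℕ :=
  sSup {n : ℕ | ∃ f : Fin (n + 1) → β, StrictMono f}

/-- The spine of a finite poset: the set of elements lying on some chain of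
maximum length. -/
noncomputable def spine (β : Type u) [Preorder β] : Set β :=
  {a : β | ∃ f : Fin (latLen β + 1) → β, StrictMono f ∧ a ∈ Set.range f}

/-- A finite lattice is extremal if `ℓ(L) = |JIrr(L)| = |MIrr(L)|`. -/
noncomputable def IsExtremal (β : Type u) [Lattice β] : Prop :=
  latLen β = {j : β | IsJoinIrred j}.ncard ∧ latLen β = {m : β | IsMeetIrred m}.ncard

/-- A description of Day's doubling through its projection `π` and its level `σ`. Unlike
`Doubling`, it is visibly invariant under order isomorphism and under order duality. -/
structure IsDoublingMap {α β : Type u} [Preorder α] [Preorder β] (C : Set α)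
    (π : β → α) (σ : β → Bool) : Prop where
  le_iff : ∀ p q, p ≤ q ↔ π p ≤ π q ∧ (π p ∈ C → π q ∈ C → σ p ≤ σ q)
  exists_lift : ∀ b x, ∃ p, π p = x ∧ (x ∈ C → σ p = b)

theorem Doubling.isDoublingMap {α β : Type u} [PartialOrder α] [PartialOrder β] {C : Set α}
    (hC : C.OrdConnected) (e : β ≃o Doubling C) :
    IsDoublingMap C (fun p => (e p).1.1) (fun p => (e p).1.2) where
  le_iff p q := by
    rw [← e.le_iff_le]
    obtain ⟨⟨x, i⟩, hp⟩ := e p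
    obtain ⟨⟨y, j⟩, hq⟩ := e q
    simp only [Subtype.mk_le_mk, Prod.mk_le_mk]
    refine ⟨fun h => ⟨h.1, fun _ _ => h.2⟩, fun h => ⟨h.1, ?_⟩⟩
    by_cases hx : x ∈ C
    · by_cases hy : y ∈ C
      · exact h.2 hx hy
      · rcases hq with ⟨_, z, hz, hyz⟩ | ⟨hj, _⟩
        · exact absurd (hC.out hx hz ⟨h.1, hyz⟩) hy
        · simp only at hj
          simp [hj]
    · rcases hp with ⟨hi, _⟩ | ⟨_, hx' | hx'⟩
      · simp only at hi
        simp [hi]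
      · rcases hq with ⟨_, z, hz, hyz⟩ | ⟨hj, _⟩
        · exact absurd ⟨z, hz, h.1.trans hyz⟩ hx'
        · simp only at hj
          simp [hj]
      · exact absurd hx' hx
  exists_lift b x := by
    by_cases hx : x ∈ C
    · cases b
      · exact ⟨e.symm ⟨(x, false), Or.inl ⟨rfl, x, hx, le_rfl⟩⟩, by simp⟩
      · exact ⟨e.symm ⟨(x, true), Or.inr ⟨rfl, Or.inr hx⟩⟩, by simp⟩
    · by_cases hI : x ∈ lowerIdeal C
      · exact ⟨e.symm ⟨(x, false), Or.inl ⟨rfl, hI⟩⟩, by simp [hx]⟩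
      · exact ⟨e.symm ⟨(x, true), Or.inr ⟨rfl, Or.inl hI⟩⟩, by simp [hx]⟩

namespace IsDoublingMap

section PartialOrder

variable {α β : Type u} [PartialOrder α] [PartialOrder β] {C : Set α} {π : β → α} {σ : β → Bool}

theorem dual (h : IsDoublingMap C π σ) :
    IsDoublingMap (α := αᵒᵈ) (β := βᵒᵈ) (OrderDual.ofDual ⁻¹' C)
      (fun p => OrderDual.toDual (π (OrderDual.ofDual p)))
      (fun p => !σ (OrderDual.ofDual p)) where
  le_iff p q := by
    rw [← OrderDual.ofDual_le_ofDual, h.le_iff, OrderDual.toDual_le_toDual]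
    simp only [Set.mem_preimage, OrderDual.ofDual_toDual]
    cases σ (OrderDual.ofDual p) <;> cases σ (OrderDual.ofDual q) <;>
      simp [imp.swap]
  exists_lift b x := by
    obtain ⟨p, hp, hb⟩ := h.exists_lift (!b) (OrderDual.ofDual x)
    exact ⟨OrderDual.toDual p, by simp [hp], fun hx => by simp [hb hx]⟩

theorem mono (h : IsDoublingMap C π σ) : Monotone π := fun p q hpq => ((h.le_iff p q).1 hpq).1

theorem ext (h : IsDoublingMap C π σ) {p q : β} (hπ : π p = π q) (hσ : π p ∈ C → σ p = σ q) :
    p = q :=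
  le_antisymm ((h.le_iff p q).2 ⟨hπ.le, fun hp _ => (hσ hp).le⟩)
    ((h.le_iff q p).2 ⟨hπ.ge, fun _ hp => (hσ hp).ge⟩)

theorem of_lt_of_eq (h : IsDoublingMap C π σ) {p q : β} (hpq : p < q) (hπ : π p = π q) :
    π p ∈ C ∧ σ p = false ∧ σ q = true := by
  have hne : ¬ (π p ∈ C → σ p = σ q) := fun hσ => hpq.ne (h.ext hπ hσ)
  push Not at hne
  have hle := ((h.le_iff p q).1 hpq.le).2 hne.1 (hπ ▸ hne.1)
  refine ⟨hne.1, ?_⟩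
  have := hne.2
  revert this hle
  cases σ p <;> cases σ q <;> simp

theorem le_total_of_eq (h : IsDoublingMap C π σ) {p q : β} (hπ : π p = π q) : p ≤ q ∨ q ≤ p := by
  rcases le_total (σ p) (σ q) with hle | hle
  · exact Or.inl ((h.le_iff p q).2 ⟨hπ.le, fun _ _ => hle⟩)
  · exact Or.inr ((h.le_iff q p).2 ⟨hπ.ge, fun _ _ => hle⟩)

theorem lt_of_lt (h : IsDoublingMap C π σ) {p q : β} (hp : π p ∈ C → σ p = false) (hqp : q < p) :
    π q < π p := by
  refine lt_of_le_of_ne (h.mono hqp.le) fun heq => ?_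
  obtain ⟨hC, _, ht⟩ := h.of_lt_of_eq hqp heq
  simp [hp (heq ▸ hC)] at ht

theorem map_covBy (h : IsDoublingMap C π σ) {p q : β} (hp : π p ∈ C → σ p = false)
    (hqp : q ⋖ p) : π q ⋖ π p := by
  classical
  refine ⟨h.lt_of_lt hp hqp.lt, fun z hqz hzp => ?_⟩
  obtain ⟨r, rfl, hr⟩ := h.exists_lift (decide (π p ∉ C)) z
  have hle := ((h.le_iff q p).1 hqp.le).2
  refine hqp.2 (c := r) (lt_of_le_of_ne ((h.le_iff q r).2 ⟨hqz.le, fun h1 h2 => ?_⟩) ?_)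
    (lt_of_le_of_ne ((h.le_iff r p).2 ⟨hzp.le, fun h1 h2 => ?_⟩) ?_)
  · by_cases hpC : π p ∈ C
    · rw [hr h2]
      simpa [hpC, hp hpC] using hle h1 hpC
    · rw [hr h2]
      simp [hpC]
  · rintro rfl
    exact hqz.ne rfl
  · simp [hr h1, h2]
  · rintro rfl
    exact hzp.ne rfl

theorem exists_covBy_lift (h : IsDoublingMap C π σ) {p : β} (hp : π p ∈ C → σ p = false) {y : α}
    (hy : y ⋖ π p) : ∃ q, π q = y ∧ q ⋖ p := by
  classical
  obtain ⟨q, rfl, hq⟩ := h.exists_lift (decide (π p ∉ C)) y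
  refine ⟨q, rfl, lt_of_le_of_ne ((h.le_iff q p).2 ⟨hy.le, fun h1 h2 => ?_⟩) ?_, ?_⟩
  · simp [hq h1, h2]
  · rintro rfl
    exact hy.ne rfl
  · intro r hqr hrp
    have hrp' := h.lt_of_lt hp hrp
    have heq : π q = π r := by
      by_contra hne
      exact hy.2 (lt_of_le_of_ne (h.mono hqr.le) hne) hrp'
    obtain ⟨hC, hf, ht⟩ := h.of_lt_of_eq hqr heq
    have hpC : π p ∈ C := by
      have := hq hC
      rw [hf] at this
      simpa using this
    have := ((h.le_iff r p).1 hrp.le).2 (heq ▸ hC) hpC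
    rw [ht, hp hpC] at this
    exact absurd this (by decide)

theorem eq_of_covBy (h : IsDoublingMap C π σ) {p q r : β} (hq : q ⋖ p) (hr : r ⋖ p)
    (hπ : π q = π r) : q = r := by
  rcases h.le_total_of_eq hπ with hle | hle
  · by_contra hne
    exact hq.2 (lt_of_le_of_ne hle hne) hr.lt
  · by_contra hne
    exact hr.2 (lt_of_le_of_ne hle (Ne.symm hne)) hq.lt

theorem existsUnique_covBy_iff (h : IsDoublingMap C π σ) {p : β} (hp : π p ∈ C → σ p = false) :
    (∃! q, q ⋖ p) ↔ ∃! y, y ⋖ π p := by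
  constructor
  · rintro ⟨q, hq, huniq⟩
    refine ⟨π q, h.map_covBy hp hq, fun y hy => ?_⟩
    obtain ⟨r, rfl, hr⟩ := h.exists_covBy_lift hp hy
    rw [huniq r hr]
  · rintro ⟨y, hy, huniq⟩
    obtain ⟨q, rfl, hq⟩ := h.exists_covBy_lift hp hy
    exact ⟨q, hq, fun r hr => h.eq_of_covBy hr hq (huniq _ (h.map_covBy hp hr))⟩

theorem existsUnique_covBy_iff_minimal [Finite β] (h : IsDoublingMap C π σ) {p : β}
    (hp : π p ∈ C) (hσ : σ p = true) : (∃! q, q ⋖ p) ↔ Minimal (· ∈ C) (π p) := by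
  obtain ⟨o, hoπ, hoσ⟩ := h.exists_lift false (π p)
  replace hoσ := hoσ hp
  have hop : o < p := by
    refine lt_of_le_of_ne ((h.le_iff o p).2 ⟨hoπ.le, fun _ _ => by simp [hσ]⟩) ?_
    rintro rfl
    simp [hσ] at hoσ
  have hcov : o ⋖ p := by
    refine ⟨hop, fun r hor hrp => ?_⟩
    have heq : π o = π r := le_antisymm (h.mono hor.le) (hoπ ▸ h.mono hrp.le)
    have h1 := (h.of_lt_of_eq hor heq).2.2
    have h2 := (h.of_lt_of_eq hrp (heq.symm.trans hoπ)).2.1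
    simp [h1] at h2
  constructor
  · rintro ⟨q, _, huniq⟩
    refine ⟨hp, fun y hy hyp => ?_⟩
    by_contra hne
    obtain ⟨r, rfl, hr⟩ := h.exists_lift true y
    replace hr := hr hy
    have hrp : r < p := by
      refine lt_of_le_of_ne ((h.le_iff r p).2 ⟨hyp, fun _ _ => by simp [hσ]⟩) ?_
      rintro rfl
      exact hne le_rfl
    obtain ⟨s, hrs, hs⟩ := hrp.exists_le_covby
    have hso : s = o := (huniq s hs).trans (huniq o hcov).symm
    subst hso
    have := ((h.le_iff r s).1 hrs).2 hy (hoπ ▸ hp)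
    rw [hr, hoσ] at this
    exact absurd this (by decide)
  · intro hmin
    refine ⟨o, hcov, fun q hq => ?_⟩
    have hqo : q ≤ o := by
      refine (h.le_iff q o).2 ⟨hoπ ▸ h.mono hq.le, fun hqC _ => ?_⟩
      have heq := hmin.eq_of_le hqC (h.mono hq.le)
      simp [(h.of_lt_of_eq hq.lt heq).2.1]
    by_contra hne
    exact hq.2 (lt_of_le_of_ne hqo hne) hop

end PartialOrder

section Lattice

variable {α β : Type u} [Lattice α] [Lattice β] [Finite α] [Finite β] {C : Set α} {π : β → α}
  {σ : β → Bool}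

theorem ncard_isJoinIrred (h : IsDoublingMap C π σ) :
    {p : β | IsJoinIrred p}.ncard =
      {x : α | IsJoinIrred x}.ncard + {x : α | Minimal (· ∈ C) x}.ncard := by
  choose g hg hgσ using h.exists_lift
  have hinj (b : Bool) : Function.Injective (g b) := fun x y hxy => by
    rw [← hg b x, hxy, hg]
  rw [← Set.ncard_image_of_injective _ (hinj false), ← Set.ncard_image_of_injective _ (hinj true),
    ← Set.ncard_union_eq _ (Set.toFinite _) (Set.toFinite _)]
  · congr 1
    ext p
    simp only [Set.mem_ofPred_eq, Set.mem_union, Set.mem_image]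
    constructor
    · intro hp
      by_cases hord : π p ∈ C → σ p = false
      · exact Or.inl ⟨π p, (h.existsUnique_covBy_iff hord).1 hp,
          h.ext (hg _ _) fun hC => by rw [hg] at hC; rw [hgσ _ _ hC, hord hC]⟩
      · push Not at hord
        have hσ : σ p = true := by simpa using hord.2
        exact Or.inr ⟨π p, (h.existsUnique_covBy_iff_minimal hord.1 hσ).1 hp,
          h.ext (hg _ _) fun hC => by rw [hg] at hC; rw [hgσ _ _ hC, hσ]⟩
    · rintro (⟨x, hx, rfl⟩ | ⟨x, hx, rfl⟩)
      · refine (h.existsUnique_covBy_iff fun hC => ?_).2 (by rwa [hg])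
        rw [hg] at hC
        exact hgσ _ _ hC
      · exact (h.existsUnique_covBy_iff_minimal (by rw [hg]; exact hx.prop)
          (hgσ _ _ hx.prop)).2 (by rwa [hg])
  · rw [Set.disjoint_left]
    rintro _ ⟨x, _, rfl⟩ ⟨y, hy, hxy⟩
    have hyx : y = x := by rw [← hg true y, hxy, hg]
    subst hyx
    have h1 := hgσ true y hy.prop
    rw [hxy, hgσ false y hy.prop] at h1
    simp at h1

end Lattice

end IsDoublingMap

theorem isJoinIrred_toDual {α : Type u} [Lattice α] (x : α) :
    IsJoinIrred (OrderDual.toDual x) ↔ IsMeetIrred x := by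
  unfold IsJoinIrred IsMeetIrred
  have hcov (y : αᵒᵈ) : y ⋖ OrderDual.toDual x ↔ x ⋖ OrderDual.ofDual y :=
    toDual_covBy_toDual_iff (a := x) (b := OrderDual.ofDual y)
  simp only [hcov]
  exact Iff.rfl

theorem IsDoublingMap.ncard_isMeetIrred {α β : Type u} [Lattice α] [Lattice β] [Finite α]
    [Finite β] {C : Set α} {π : β → α} {σ : β → Bool} (h : IsDoublingMap C π σ) :
    {p : β | IsMeetIrred p}.ncard =
      {x : α | IsMeetIrred x}.ncard + {x : α | Maximal (· ∈ C) x}.ncard := by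
  have hd := h.dual.ncard_isJoinIrred
  have hβ : {p : β | IsMeetIrred p} = {p : βᵒᵈ | IsJoinIrred p} :=
    Set.ext fun p => (isJoinIrred_toDual p).symm
  have hα : {x : α | IsMeetIrred x} = {x : αᵒᵈ | IsJoinIrred x} :=
    Set.ext fun x => (isJoinIrred_toDual x).symm
  rw [hβ, hα]
  exact hd

section Length

variable {α β : Type u}

theorem bddAbove_chain_lengths (β : Type u) [Preorder β] [Finite β] :
    BddAbove {n : ℕ | ∃ f : Fin (n + 1) → β, StrictMono f} := by
  refine ⟨Nat.card β, ?_⟩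
  rintro n ⟨f, hf⟩
  have := Nat.card_le_card_of_injective f hf.injective
  rw [Nat.card_fin] at this
  omega

theorem le_latLen [Preorder β] [Finite β] {n : ℕ} {f : Fin (n + 1) → β} (hf : StrictMono f) :
    n ≤ latLen β :=
  le_csSup (bddAbove_chain_lengths β) ⟨f, hf⟩

theorem exists_strictMono_latLen (β : Type u) [Preorder β] [Finite β] [Nonempty β] :
    ∃ f : Fin (latLen β + 1) → β, StrictMono f :=
  Nat.sSup_mem (s := {n : ℕ | ∃ f : Fin (n + 1) → β, StrictMono f})
    ⟨0, fun _ => Classical.arbitrary β, fun i j hij => absurd hij (by omega)⟩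
    (bddAbove_chain_lengths β)

namespace IsDoublingMap

variable [PartialOrder α] [PartialOrder β] {C : Set α} {π : β → α} {σ : β → Bool}

theorem latLen_succ_le [Finite β] (h : IsDoublingMap C π σ) (hC : (C ∩ spine α).Nonempty) :
    latLen α + 1 ≤ latLen β := by
  obtain ⟨_, hxC, f, hf, k, rfl⟩ := hC
  choose g hg hgσ using h.exists_lift
  have hle (b c : Bool) {i j : Fin (latLen α + 1)} (hbc : b ≤ c) (hij : i ≤ j) :
      g b (f i) ≤ g c (f j) := by
    refine (h.le_iff _ _).2 ⟨by simpa [hg] using hf.monotone hij, ?_⟩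
    simp only [hg]
    intro h1 h2
    rwa [hgσ _ _ h1, hgσ _ _ h2]
  have hlt (b c : Bool) {i j : Fin (latLen α + 1)} (hbc : b ≤ c) (hij : i < j) :
      g b (f i) < g c (f j) := by
    refine lt_of_le_of_ne (hle b c hbc hij.le) fun heq => (hf hij).ne ?_
    rw [← hg b (f i), heq, hg]
  have hk : g false (f k) < g true (f k) := by
    refine lt_of_le_of_ne (hle _ _ (by simp) le_rfl) fun heq => ?_
    have := hgσ false _ hxC
    rw [heq, hgσ true _ hxC] at this
    simp at this
  refine le_latLen (f := fun i : Fin (latLen α + 1 + 1) =>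
    if hi : i.val ≤ k.val then g false (f ⟨i, by omega⟩) else g true (f ⟨i - 1, by omega⟩)) ?_
  rw [Fin.strictMono_iff_lt_succ]
  intro i
  simp only [Fin.val_castSucc, Fin.val_succ]
  rcases lt_trichotomy i.val k.val with hik | hik | hik
  · rw [dif_pos hik.le, dif_pos (by omega)]
    exact hlt _ _ le_rfl (Fin.mk_lt_mk.2 (by omega))
  · rw [dif_pos hik.le, dif_neg (by omega)]
    have : i = k := Fin.ext hik
    subst this
    exact hk
  · rw [dif_neg (by omega), dif_neg (by omega)]
    exact hlt _ _ le_rfl (Fin.mk_lt_mk.2 (by omega))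

/-- A chain of a doubling either projects to a chain or does so after omitting one of two
consecutive elements lying over the same element of `C`. -/
theorem strictMono_comp_or (h : IsDoublingMap C π σ) {m : ℕ} {f : Fin (m + 1) → β}
    (hf : StrictMono f) :
    StrictMono (π ∘ f) ∨
      ∃ i : Fin m, π (f i.succ) ∈ C ∧ StrictMono (π ∘ f ∘ i.castSucc.succAbove) := by
  rw [or_iff_not_imp_left, Fin.strictMono_iff_lt_succ]
  push Not
  rintro ⟨i, hi⟩
  have hi' : f i.castSucc < f i.succ := hf i.castSucc_lt_succ
  have heq : π (f i.castSucc) = π (f i.succ) := by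
    by_contra hne
    exact hi (lt_of_le_of_ne (h.mono hi'.le) hne)
  obtain ⟨hiC, hif, hit⟩ := h.of_lt_of_eq hi' heq
  refine ⟨i, heq ▸ hiC, fun a b hab => ?_⟩
  have hlt : i.castSucc.succAbove a < i.castSucc.succAbove b :=
    Fin.strictMono_succAbove _ hab
  have hane := Fin.succAbove_ne i.castSucc a
  simp only [Function.comp_apply]
  generalize i.castSucc.succAbove a = p at *
  generalize i.castSucc.succAbove b = q at *
  refine lt_of_le_of_ne (h.mono (hf hlt).le) fun hpq => ?_
  obtain ⟨hpC, hpf, hqt⟩ := h.of_lt_of_eq (hf hlt) hpq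
  have hpi : p < i.castSucc := by
    by_contra hge
    have hip : i.succ ≤ p := Fin.castSucc_lt_iff_succ_le.1 (lt_of_le_of_ne (not_lt.1 hge) hane.symm)
    have := ((h.le_iff _ _).1 (hf.monotone hip)).2 (heq ▸ hiC) hpC
    rw [hit, hpf] at this
    exact absurd this (by decide)
  have hiq : i.castSucc < q := by
    by_contra hge
    have := ((h.le_iff _ _).1 (hf.monotone (not_lt.1 hge))).2 (hpq ▸ hpC) hiC
    rw [hqt, hif] at this
    exact absurd this (by decide)
  have hpi' : π (f p) = π (f i.castSucc) :=
    le_antisymm (h.mono (hf hpi).le) (hpq ▸ h.mono (hf hiq).le)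
  have := (h.of_lt_of_eq (hf hpi) hpi').2.2
  simp [hif] at this

theorem latLen_le_succ [Finite α] [Finite β] [Nonempty β] (h : IsDoublingMap C π σ) :
    latLen β ≤ latLen α + 1 := by
  obtain ⟨f, hf⟩ := exists_strictMono_latLen β
  generalize latLen β = m at f hf
  rcases h.strictMono_comp_or hf with hπ | ⟨i, _, hπ⟩
  · exact (le_latLen hπ).trans (Nat.le_succ _)
  · cases m with
    | zero => omega
    | succ m => exact Nat.succ_le_succ (le_latLen hπ)

theorem inter_spine_nonempty [Finite α] [Finite β] [Nonempty β] (h : IsDoublingMap C π σ)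
    (hlen : latLen β = latLen α + 1) : (C ∩ spine α).Nonempty := by
  obtain ⟨f, hf⟩ := exists_strictMono_latLen β
  generalize latLen β = m at f hf hlen
  subst hlen
  rcases h.strictMono_comp_or hf with hπ | ⟨i, hiC, hπ⟩
  · have := le_latLen hπ
    omega
  · exact ⟨_, hiC, _, hπ, i, by simp⟩

theorem latLen_eq_succ_iff [Finite α] [Finite β] [Nonempty β] (h : IsDoublingMap C π σ) :
    latLen β = latLen α + 1 ↔ (C ∩ spine α).Nonempty :=
  ⟨h.inter_spine_nonempty, fun hC => le_antisymm h.latLen_le_succ (h.latLen_succ_le hC)⟩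

end IsDoublingMap

end Length

theorem ncard_setOf_minimal_pos {α : Type u} [PartialOrder α] [Finite α] {C : Set α}
    (hC : C.Nonempty) : 0 < {x | Minimal (· ∈ C) x}.ncard :=
  (Set.ncard_pos (Set.toFinite _)).2 ((Set.toFinite C).exists_minimal hC)

theorem ncard_setOf_maximal_pos {α : Type u} [PartialOrder α] [Finite α] {C : Set α}
    (hC : C.Nonempty) : 0 < {x | Maximal (· ∈ C) x}.ncard :=
  (Set.ncard_pos (Set.toFinite _)).2 ((Set.toFinite C).exists_maximal hC)

theorem exists_eq_Icc_iff {α : Type u} [PartialOrder α] [Finite α] {C : Set α}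
    (hne : C.Nonempty) (hC : C.OrdConnected) :
    (∃ a b, C = Set.Icc a b) ↔
      {x | Minimal (· ∈ C) x}.ncard = 1 ∧ {x | Maximal (· ∈ C) x}.ncard = 1 := by
  simp only [Set.ncard_eq_one]
  constructor
  · rintro ⟨a, b, rfl⟩
    have hab : a ≤ b := Set.nonempty_Icc.1 hne
    refine ⟨⟨a, Set.ext fun x => ⟨fun hx => ?_, ?_⟩⟩, ⟨b, Set.ext fun x => ⟨fun hx => ?_, ?_⟩⟩⟩
    · exact (hx.eq_of_le ⟨le_rfl, hab⟩ hx.prop.1).symm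
    · rintro rfl
      exact ⟨⟨le_rfl, hab⟩, fun y hy _ => hy.1⟩
    · exact (hx.eq_of_ge ⟨hab, le_rfl⟩ hx.prop.2).symm
    · rintro rfl
      exact ⟨⟨hab, le_rfl⟩, fun y hy _ => hy.2⟩
  · rintro ⟨⟨a, ha⟩, ⟨b, hb⟩⟩
    have ha' : Minimal (· ∈ C) a := ha.ge rfl
    have hb' : Maximal (· ∈ C) b := hb.ge rfl
    refine ⟨a, b, Set.Subset.antisymm (fun x hx => ⟨?_, ?_⟩) (hC.out ha'.prop hb'.prop)⟩
    · obtain ⟨m, hmx, hm⟩ := (Set.toFinite C).exists_le_minimal hx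
      rwa [← show m = a from ha.le hm]
    · obtain ⟨m, hmx, hm⟩ := (Set.toFinite C).exists_le_maximal hx
      rwa [← show m = b from hb.le hm]

theorem latLen_of_subsingleton (β : Type u) [Preorder β] [Subsingleton β] [Nonempty β] :
    latLen β = 0 := by
  obtain ⟨f, hf⟩ := exists_strictMono_latLen β
  by_contra hne
  have h0 : (0 : Fin (latLen β + 1)) < Fin.last _ := Fin.pos_iff_ne_zero.2 (by simpa [Fin.ext_iff])
  exact (hf h0).ne (Subsingleton.elim _ _)

/-- A congruence normal lattice `L = E[C_1, …, C_n]`, obtained from the one-element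
lattice `K 0` by successively doubling nonempty convex subsets `C i` (so that
`K (i+1) ≅ (K i)[C i]` and `L = K n`), is extremal if and only if every `C i` is an
interval of `K i` intersecting the spine of `K i`. -/
theorem congruenceNormal_extremal_iff (n : ℕ) (K : Fin (n + 1) → Type u)
    [instK : ∀ i, Lattice (K i)] [instF : ∀ i, Fintype (K i)]
    (hone : Subsingleton (K 0)) (hone' : Nonempty (K 0))
    (C : (i : Fin n) → Set (K i.castSucc))
    (hne : ∀ i, (C i).Nonempty) (hconv : ∀ i, (C i).OrdConnected)
    (e : (i : Fin n) → (K i.succ ≃o Doubling (C i))) :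
    IsExtremal (K (Fin.last n)) ↔
      ∀ i : Fin n, (∃ a b : K i.castSucc, C i = Set.Icc a b) ∧
        (C i ∩ spine (K i.castSucc)).Nonempty := by
  have hdbl (i : Fin n) := Doubling.isDoublingMap (hconv i) (e i)
  have hnonempty : ∀ i, Nonempty (K i) := Fin.induction hone' fun i _ =>
    let ⟨p, _⟩ := (hdbl i).exists_lift true (hne i).some
    ⟨p⟩
  have key : ∀ i : Fin (n + 1),
      latLen (K i) ≤ {j : K i | IsJoinIrred j}.ncard ∧
      latLen (K i) ≤ {m : K i | IsMeetIrred m}.ncard ∧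
      (IsExtremal (K i) ↔ ∀ j : Fin n, j.castSucc < i →
        (∃ a b : K j.castSucc, C j = Set.Icc a b) ∧
          (C j ∩ spine (K j.castSucc)).Nonempty) := by
    refine Fin.induction ?_ fun i ih => ?_
    · have hlen := latLen_of_subsingleton (K 0)
      have hJ : {j : K 0 | IsJoinIrred j} = ∅ :=
        Set.eq_empty_of_forall_notMem fun j ⟨b, hb, _⟩ => hb.ne (Subsingleton.elim _ _)
      have hM : {m : K 0 | IsMeetIrred m} = ∅ :=
        Set.eq_empty_of_forall_notMem fun m ⟨b, hb, _⟩ => hb.ne (Subsingleton.elim _ _)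
      simp [IsExtremal, hlen, hJ, hM]
    · obtain ⟨ihJ, ihM, ih⟩ := ih
      have hJ := (hdbl i).ncard_isJoinIrred
      have hM := (hdbl i).ncard_isMeetIrred
      have hle := (hdbl i).latLen_le_succ
      have hmin := ncard_setOf_minimal_pos (hne i)
      have hmax := ncard_setOf_maximal_pos (hne i)
      refine ⟨by omega, by omega, ?_⟩
      have hsplit (P : Fin n → Prop) :
          (∀ j : Fin n, j.castSucc < i.succ → P j) ↔
            (∀ j : Fin n, j.castSucc < i.castSucc → P j) ∧ P i := by
        simp only [Fin.castSucc_lt_succ_iff, Fin.castSucc_lt_castSucc_iff, le_iff_lt_or_eq]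
        exact ⟨fun h => ⟨fun j hj => h j (Or.inl hj), h i (Or.inr rfl)⟩,
          fun h j hj => hj.elim (h.1 j) fun hji => hji ▸ h.2⟩
      rw [hsplit, ← ih, exists_eq_Icc_iff (hne i) (hconv i), ← (hdbl i).latLen_eq_succ_iff]
      unfold IsExtremal
      omega
  rw [(key (Fin.last n)).2.2]
  exact forall_congr' fun i => by simp [Fin.castSucc_lt_last]
end
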